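/- arXiv:1703.03960 — 2 statements merged into one kernel-verified Lean document; each statement's English description precedes it below -/
import Mathlib

section
/- Compatibility of the James–Hopf invariants with the Magnus expansion: let X be a type, ℓ = [(x₁,ε₁),…,(xₙ,εₙ)] any word over X, k ≥ 1 and L ≥ k. Then in the tensor algebra TensorAlgebra ℤ (X →₀ ℤ), the degree-k graded component (with respect to the standard grading) of the Magnus expansion M_L(ℓ) equals Ψ_k(φ_k(ℓ)), the abelianization of the k-th James–Hopf word of ℓ. Explicitly, π_k(m₁⋯mₙ) = Σ (ε_{i₁}⋯ε_{i_k})·ι(x_{i₁})ι(x_{i₂})⋯ι(x_{i_k}), the sum running over all k-admissible sequences (i₁,…,i_k) for ℓ. -/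
/-- A sequence of (0-based) positions `s 0 ≤ s 1 ≤ … ≤ s (k-1)` in the word `ℓ`
is `k`-admissible if consecutive positions strictly increase whenever the
letter at the later position has exponent `+1` (repetitions may only occur at
letters with exponent `-1`). -/
def Admissible {X : Type*} (ℓ : List (X × Bool)) {k : ℕ} (s : Fin k → ℕ) : Prop :=
  (∀ j, s j < ℓ.length) ∧
  ∀ (j : ℕ) (hj : j + 1 < k),
    if (ℓ.map Prod.snd).getD (s ⟨j + 1, hj⟩) true = true
    then s ⟨j, Nat.lt_of_succ_lt hj⟩ < s ⟨j + 1, hj⟩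
    else s ⟨j, Nat.lt_of_succ_lt hj⟩ ≤ s ⟨j + 1, hj⟩

open Classical in
/-- The `k`-th James–Hopf word map `φ_k`: the product, over all `k`-admissible
sequences for `ℓ` taken in right-lexicographic order (encoded by the base-`ℓ.length`
code `c = Σ_j (s j)·ℓ.length^j`, so increasing `c` is exactly right-lex order),
of the generator `(x_{i₁},…,x_{i_k})` raised to the power `ε_{i₁}⋯ε_{i_k}`. -/
noncomputable def jamesHopfWord {X : Type*} (k : ℕ) (ℓ : List (X × Bool)) :
    FreeGroup (Fin k → X) :=
  ((List.range (ℓ.length ^ k)).map (fun c =>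
    let s : Fin k → ℕ := fun j => c / ℓ.length ^ (j : ℕ) % ℓ.length
    if h : Admissible ℓ s then
      (FreeGroup.of (fun j => (ℓ.get ⟨s j, h.1 j⟩).1)) ^
        ((List.ofFn fun j : Fin k =>
          if (ℓ.get ⟨s j, h.1 j⟩).2 then (1 : ℤ) else -1).prod)
    else 1)).prod

/-- The degree-one generator `ι(x)` of the tensor algebra `T(ℤ[X])`:
the image of the basis element `Finsupp.single x 1`. -/
noncomputable def gen (X : Type*) (x : X) : TensorAlgebra ℤ (X →₀ ℤ) :=
  TensorAlgebra.ι ℤ (Finsupp.single x (1 : ℤ))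

/-- `Ψ_k : FreeGroup (Fin k → X) → T(ℤ[X])`, sending `g` to the sum, over the
letters `((y₁,…,y_k), ε)` of the reduced word of `g`, of `ε·ι(y₁)⋯ι(y_k)`. -/
noncomputable def psi {X : Type*} [DecidableEq X] (k : ℕ)
    (g : FreeGroup (Fin k → X)) : TensorAlgebra ℤ (X →₀ ℤ) :=
  ((FreeGroup.toWord g).map fun yε =>
    (if yε.2 then (1 : ℤ) else -1) •
      (List.ofFn fun j : Fin k => gen X (yε.1 j)).prod).sum

/-- The truncated Magnus expansion `M_L(ℓ) = m₁⋯mₙ`, where `mᵢ = 1 + ι(xᵢ)` if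
`εᵢ = +1` and `mᵢ = Σ_{j=0}^{L} (−1)^j ι(xᵢ)^j` if `εᵢ = −1`. -/
noncomputable def magnus {X : Type*} (L : ℕ) (ℓ : List (X × Bool)) :
    TensorAlgebra ℤ (X →₀ ℤ) :=
  (ℓ.map fun xε =>
    if xε.2 then 1 + gen X xε.1
    else ∑ j ∈ Finset.range (L + 1), (-1 : ℤ) ^ j • (gen X xε.1) ^ j).prod

/-- Projection `π_k` onto the degree-`k` graded component of the standard
grading of the tensor algebra. -/
noncomputable def degProj (X : Type*) (k : ℕ) :
    TensorAlgebra ℤ (X →₀ ℤ) →ₗ[ℤ] TensorAlgebra ℤ (X →₀ ℤ) :=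
  GradedAlgebra.proj
    (fun n : ℕ => LinearMap.range (TensorAlgebra.ι ℤ :
      (X →₀ ℤ) →ₗ[ℤ] TensorAlgebra ℤ (X →₀ ℤ)) ^ n) k

/-- The signed generator `ε_i · ι(x_i)` attached to the `i`-th letter of `ℓ`. -/
noncomputable def signedGen {X : Type*} (ℓ : List (X × Bool)) (i : Fin ℓ.length) :
    TensorAlgebra ℤ (X →₀ ℤ) :=
  (if (ℓ.get i).2 then (1 : ℤ) else -1) • gen X (ℓ.get i).1

open Classical in
/-- The sum over all `k`-admissible sequences of the products of signed generators. -/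
noncomputable def admissibleSum {X : Type*} (k : ℕ) (ℓ : List (X × Bool)) :
    TensorAlgebra ℤ (X →₀ ℤ) :=
  ∑ s : Fin k → Fin ℓ.length,
    if Admissible ℓ (fun j => (s j : ℕ)) then (List.ofFn fun j => signedGen ℓ (s j)).prod else 0

theorem Admissible.monotone {X : Type*} {ℓ : List (X × Bool)} {k : ℕ} {s : Fin k → ℕ}
    (h : Admissible ℓ s) : Monotone s := by
  cases k with
  | zero => exact fun i => i.elim0
  | succ k =>
    refine Fin.monotone_iff_le_succ.2 fun i => ?_
    have := h.2 i (by omega)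
    split_ifs at this
    exacts [this.le, this]

theorem admissible_cons_succ_iff {X : Type*} (a : X × Bool) (ℓ : List (X × Bool)) {k : ℕ}
    (s : Fin k → ℕ) : Admissible (a :: ℓ) (fun j => s j + 1) ↔ Admissible ℓ s := by
  simp [Admissible]

theorem admissible_cons_finCons_zero_iff {X : Type*} (a : X × Bool) (ℓ : List (X × Bool)) {k : ℕ}
    (s : Fin k → ℕ) :
    Admissible (a :: ℓ) (Fin.cons 0 s : Fin (k + 1) → ℕ) ↔
      Admissible (a :: ℓ) s ∧ (a.2 = true → ∀ j, s j ≠ 0) := by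
  constructor
  · intro h
    refine ⟨⟨fun j => by simpa using h.1 j.succ, fun j hj => h.2 (j + 1) (by omega)⟩, ?_⟩
    intro ha j
    have hk : 0 < k := j.pos
    have h0 := h.2 0 (by omega)
    have h1 : s ⟨0, hk⟩ ≠ 0 := by
      intro h1
      have e : (Fin.cons 0 s : Fin (k + 1) → ℕ) ⟨0 + 1, by omega⟩ = s ⟨0, hk⟩ := rfl
      rw [e, h1] at h0
      simp [ha] at h0
    have := h.monotone (show (⟨0, hk⟩ : Fin k).succ ≤ j.succ from
      Fin.succ_le_succ_iff.2 (Nat.zero_le _))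
    simp only [Fin.cons_succ] at this
    omega
  · rintro ⟨h, h'⟩
    refine ⟨Fin.cases (by simp) fun j => by simpa using h.1 j, fun j hj => ?_⟩
    cases j with
    | zero =>
      have e : (Fin.cons 0 s : Fin (k + 1) → ℕ) ⟨0 + 1, hj⟩ = s ⟨0, by omega⟩ := rfl
      have e0 : (Fin.cons 0 s : Fin (k + 1) → ℕ) ⟨0, by omega⟩ = 0 := rfl
      rw [e, e0]
      split_ifs with hc
      · refine Nat.pos_of_ne_zero fun h0 => ?_
        rw [h0] at hc
        exact h' (by simpa using hc) _ h0
      · exact Nat.zero_le _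
    | succ j => exact h.2 j (by omega)

open Classical in
theorem admissibleSum_eq_sum_cons {X : Type*} (k : ℕ) (a : X × Bool) (ℓ : List (X × Bool)) :
    admissibleSum k ℓ = ∑ s : Fin k → Fin (a :: ℓ).length,
      if Admissible (a :: ℓ) (fun j => (s j : ℕ)) ∧ ∀ j, (s j : ℕ) ≠ 0 then
        (List.ofFn fun j => signedGen (a :: ℓ) (s j)).prod else 0 := by
  refine Fintype.sum_of_injective (fun s j => (s j).succ) ?_ _ _ ?_ ?_
  · intro s t h
    funext j
    exact Fin.succ_injective _ (congrFun h j)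
  · intro s hs
    rw [if_neg]
    rintro ⟨-, h⟩
    refine hs ⟨fun j => (s j).pred (fun h0 => h j (by simp [h0])), ?_⟩
    funext j
    simp
  · intro s
    have : Admissible (a :: ℓ) (fun j => ((s j).succ : ℕ)) ↔ Admissible ℓ (fun j => (s j : ℕ)) :=
      admissible_cons_succ_iff a ℓ _
    simp only [this]
    simp [signedGen]

open Classical in
theorem admissibleSum_succ_cons {X : Type*} (k : ℕ) (a : X × Bool) (ℓ : List (X × Bool)) :
    admissibleSum (k + 1) (a :: ℓ) = admissibleSum (k + 1) ℓ +
      if a.2 then gen X a.1 * admissibleSum k ℓ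
      else -(gen X a.1 * admissibleSum k (a :: ℓ)) := by
  let F (s : Fin (k + 1) → Fin (a :: ℓ).length) :=
    (List.ofFn fun j => signedGen (a :: ℓ) (s j)).prod
  let A (s : Fin (k + 1) → Fin (a :: ℓ).length) := Admissible (a :: ℓ) (fun j => (s j : ℕ))
  have split : admissibleSum (k + 1) (a :: ℓ) =
      (∑ s, if A s ∧ ∀ j, (s j : ℕ) ≠ 0 then F s else 0) +
        ∑ s, if A s ∧ (s 0 : ℕ) = 0 then F s else 0 := by
    rw [← Finset.sum_add_distrib]
    refine Finset.sum_congr rfl fun s _ => ?_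
    by_cases hA : A s
    · have : (∀ j, (s j : ℕ) ≠ 0) ↔ (s 0 : ℕ) ≠ 0 := by
        refine ⟨fun h => h 0, fun h j hj => h ?_⟩
        have := hA.monotone (Fin.zero_le j)
        omega
      have hA' : Admissible (a :: ℓ) (fun j => (s j : ℕ)) := hA
      by_cases h0 : (s 0 : ℕ) = 0
      · rw [if_pos hA', if_neg (fun h => this.1 h.2 h0), if_pos ⟨hA, h0⟩, zero_add]
      · rw [if_pos hA', if_pos ⟨hA, this.2 h0⟩, if_neg (fun h => h0 h.2), add_zero]
    · have hA' : ¬ Admissible (a :: ℓ) (fun j => (s j : ℕ)) := hA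
      simp [hA, hA']
  have first : (∑ s, if A s ∧ (s 0 : ℕ) = 0 then F s else 0) =
      ∑ s : Fin k → Fin (a :: ℓ).length,
        if Admissible (a :: ℓ) (fun j => (s j : ℕ)) ∧ (a.2 = true → ∀ j, (s j : ℕ) ≠ 0) then
          ((if a.2 then (1 : ℤ) else -1) • gen X a.1) *
            (List.ofFn fun j => signedGen (a :: ℓ) (s j)).prod else 0 := by
    symm
    refine Fintype.sum_of_injective
      (fun s => (Fin.cons ⟨0, by simp⟩ s : Fin (k + 1) → Fin (a :: ℓ).length)) ?_ _ _ ?_ ?_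
    · exact Fin.cons_right_injective (α := fun _ => Fin (a :: ℓ).length) _
    · intro s hs
      rw [if_neg]
      rintro ⟨-, h⟩
      refine hs ⟨Fin.tail s, ?_⟩
      have h0 : (⟨0, by simp⟩ : Fin (a :: ℓ).length) = s 0 := Fin.ext h.symm
      simp only [h0, Fin.cons_self_tail]
    · intro s
      have e : A (Fin.cons ⟨0, by simp⟩ s) ↔
          Admissible (a :: ℓ) (Fin.cons 0 (fun j => (s j : ℕ)) : Fin (k + 1) → ℕ) := by
        refine iff_of_eq (congrArg (Admissible (a :: ℓ)) ?_)
        funext j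
        refine Fin.cases rfl (fun _ => rfl) j
      simp only [e, admissible_cons_finCons_zero_iff, Fin.cons_zero, and_true]
      simp [F, signedGen, List.ofFn_succ]
  rw [split, first, ← admissibleSum_eq_sum_cons (k + 1) a ℓ]
  congr 1
  cases ha : a.2
  · simp only [admissibleSum, Finset.mul_sum, ← Finset.sum_neg_distrib]
    refine Finset.sum_congr rfl fun s _ => ?_
    split_ifs <;> simp_all
  · rw [admissibleSum_eq_sum_cons k a ℓ]
    simp [Finset.mul_sum]

theorem admissibleSum_zero {X : Type*} (ℓ : List (X × Bool)) : admissibleSum 0 ℓ = 1 := by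
  simp [admissibleSum, Admissible]

theorem gen_pow_mem {X : Type*} (x : X) (n : ℕ) :
    gen X x ^ n ∈ LinearMap.range (TensorAlgebra.ι ℤ :
      (X →₀ ℤ) →ₗ[ℤ] TensorAlgebra ℤ (X →₀ ℤ)) ^ n :=
  Submodule.pow_mem_pow _ (LinearMap.mem_range_self _ _) n

theorem degProj_gen_pow_mul {X : Type*} (x : X) (n k : ℕ) (b : TensorAlgebra ℤ (X →₀ ℤ)) :
    degProj X (n + k) (gen X x ^ n * b) = gen X x ^ n * degProj X k b :=
  DirectSum.coe_decompose_mul_add_of_left_mem _ (gen_pow_mem x n)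

theorem degProj_gen_pow_mul_of_lt {X : Type*} (x : X) {n k : ℕ} (h : k < n)
    (b : TensorAlgebra ℤ (X →₀ ℤ)) : degProj X k (gen X x ^ n * b) = 0 :=
  DirectSum.coe_decompose_mul_of_left_mem_of_not_le _ (gen_pow_mem x n) h.not_ge

theorem degProj_one {X : Type*} (k : ℕ) : degProj X k 1 = if k = 0 then 1 else 0 := by
  have h1 : (1 : TensorAlgebra ℤ (X →₀ ℤ)) ∈ LinearMap.range (TensorAlgebra.ι ℤ :
      (X →₀ ℤ) →ₗ[ℤ] TensorAlgebra ℤ (X →₀ ℤ)) ^ 0 := by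
    rw [pow_zero]
    exact Submodule.one_le.1 le_rfl
  split_ifs with h
  · subst h
    exact DirectSum.decompose_of_mem_same _ h1
  · exact DirectSum.decompose_of_mem_ne _ h1 (Ne.symm h)

theorem sum_neg_one_pow_smul_pow {A : Type*} [Ring A] (g : A) (L : ℕ) :
    ∑ j ∈ Finset.range (L + 1), (-1 : ℤ) ^ j • g ^ j =
      1 - g * (∑ j ∈ Finset.range (L + 1), (-1 : ℤ) ^ j • g ^ j) +
        (-1 : ℤ) ^ L • g ^ (L + 1) := by
  have h : g * (∑ j ∈ Finset.range (L + 1), (-1 : ℤ) ^ j • g ^ j) =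
      -∑ j ∈ Finset.range (L + 1), (-1 : ℤ) ^ (j + 1) • g ^ (j + 1) := by
    rw [Finset.mul_sum, ← Finset.sum_neg_distrib]
    refine Finset.sum_congr rfl fun j _ => ?_
    rw [mul_smul_comm, ← pow_succ', pow_succ (-1 : ℤ)]
    simp
  rw [h, Finset.sum_range_succ (fun j => (-1 : ℤ) ^ (j + 1) • g ^ (j + 1)), Finset.sum_range_succ']
  rw [pow_succ (-1 : ℤ) L]
  simp only [pow_zero, one_smul, mul_neg, mul_one, neg_smul]
  abel

theorem magnus_cons_true {X : Type*} (L : ℕ) (x : X) (ℓ : List (X × Bool)) :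
    magnus L ((x, true) :: ℓ) = magnus L ℓ + gen X x ^ 1 * magnus L ℓ := by
  simp [magnus, add_mul]

theorem magnus_cons_false {X : Type*} (L : ℕ) (x : X) (ℓ : List (X × Bool)) :
    magnus L ((x, false) :: ℓ) = magnus L ℓ - gen X x ^ 1 * magnus L ((x, false) :: ℓ) +
      (-1 : ℤ) ^ L • (gen X x ^ (L + 1) * magnus L ℓ) := by
  have h : magnus L ((x, false) :: ℓ) =
      (∑ j ∈ Finset.range (L + 1), (-1 : ℤ) ^ j • gen X x ^ j) * magnus L ℓ := by
    simp [magnus]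
  rw [h]
  conv_lhs => rw [sum_neg_one_pow_smul_pow]
  rw [add_mul, sub_mul, one_mul, smul_mul_assoc, pow_one, mul_assoc]

theorem degProj_magnus_eq_admissibleSum {X : Type*} (L : ℕ) (ℓ : List (X × Bool)) (k : ℕ)
    (hL : k ≤ L) : degProj X k (magnus L ℓ) = admissibleSum k ℓ := by
  induction ℓ generalizing k with
  | nil =>
    cases k with
    | zero => simp [magnus, degProj_one, admissibleSum_zero]
    | succ k =>
      have : IsEmpty (Fin ([] : List (X × Bool)).length) := by simpa using Fin.isEmpty
      simp [magnus, degProj_one, admissibleSum]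
  | cons a ℓ ih =>
    obtain ⟨x, ε⟩ := a
    induction k with
    | zero =>
      rw [admissibleSum_zero, ← admissibleSum_zero ℓ, ← ih 0 hL]
      cases ε
      · rw [magnus_cons_false, map_add, map_sub, map_zsmul,
          degProj_gen_pow_mul_of_lt x one_pos, degProj_gen_pow_mul_of_lt x L.succ_pos]
        simp
      · rw [magnus_cons_true, map_add, degProj_gen_pow_mul_of_lt x one_pos, add_zero]
    | succ k ihk =>
      rw [admissibleSum_succ_cons, ← ih (k + 1) hL]
      cases ε
      · rw [magnus_cons_false, map_add, map_sub, map_zsmul, add_comm k 1, degProj_gen_pow_mul,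
          degProj_gen_pow_mul_of_lt x (by omega), ihk (by omega)]
        simp [sub_eq_add_neg]
      · rw [magnus_cons_true, map_add, add_comm k 1, degProj_gen_pow_mul, ih k (by omega)]
        simp

/-- `psi` as a homomorphism to the additive group of the tensor algebra. -/
noncomputable def psiHom (X : Type*) (k : ℕ) :
    FreeGroup (Fin k → X) →* Multiplicative (TensorAlgebra ℤ (X →₀ ℤ)) :=
  FreeGroup.lift fun y => Multiplicative.ofAdd (List.ofFn fun j => gen X (y j)).prod

theorem psi_eq_psiHom {X : Type*} [DecidableEq X] (k : ℕ) (g : FreeGroup (Fin k → X)) :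
    psi k g = (psiHom X k g).toAdd := by
  conv_rhs => rw [← FreeGroup.mk_toWord (x := g)]
  rw [psiHom, FreeGroup.lift_mk, psi, toAdd_list_sum, List.map_map]
  congr 2
  funext ⟨y, ε⟩
  cases ε <;> simp

theorem prod_ofFn_smul {A : Type*} [Ring A] {k : ℕ} (c : Fin k → ℤ) (f : Fin k → A) :
    (List.ofFn fun j => c j • f j).prod = (List.ofFn c).prod • (List.ofFn f).prod := by
  induction k with
  | zero => simp
  | succ k ih => simp only [List.ofFn_succ, List.prod_cons, ih, smul_mul_smul_comm]

open Classical in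
theorem psi_jamesHopfWord {X : Type*} [DecidableEq X] (k : ℕ) (ℓ : List (X × Bool)) :
    psi k (jamesHopfWord k ℓ) = admissibleSum k ℓ := by
  rw [psi_eq_psiHom, jamesHopfWord, map_list_prod, toAdd_list_sum, List.map_map, List.map_map]
  change ∑ c ∈ Finset.range (ℓ.length ^ k), _ = _
  rw [Finset.sum_range, admissibleSum]
  refine Fintype.sum_equiv finFunctionFinEquiv.symm _ _ fun c => ?_
  have hc (j : Fin k) : ((finFunctionFinEquiv.symm c) j : ℕ) = c / ℓ.length ^ (j : ℕ) % ℓ.length :=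
    rfl
  simp only [Function.comp_apply, hc]
  split_ifs with h
  · simp only [map_zpow, toAdd_zpow, psiHom, FreeGroup.lift_apply_of, toAdd_ofAdd, signedGen]
    rw [prod_ofFn_smul]
    rfl
  · simp

/-- Compatibility of the James–Hopf invariants with the Magnus expansion: for
any word `ℓ`, any `k ≥ 1` and any `L ≥ k`, the degree-`k` graded component of
the Magnus expansion `M_L(ℓ)` equals `Ψ_k(φ_k(ℓ))`, the abelianization of the
`k`-th James–Hopf word of `ℓ`. -/
theorem degProj_magnus_eq_psi_jamesHopf {X : Type*} [DecidableEq X]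
    (ℓ : List (X × Bool)) (k L : ℕ) (hk : 1 ≤ k) (hL : k ≤ L) :
    degProj X k (magnus L ℓ) = psi k (jamesHopfWord k ℓ) := by
  rw [degProj_magnus_eq_admissibleSum L ℓ k hL, psi_jamesHopfWord]
end

section
/- The total James–Hopf map is injective: for a type X and elements g, h ∈ FreeGroup X, if φ_k(toWord g) = φ_k(toWord h) in FreeGroup (Fin k → X) for every k ≥ 1, then g = h. Equivalently, the map H = ∏_{k≥1} H_k : FreeGroup X → ∏_{k≥1} FreeGroup (Fin k → X), g ↦ (φ_k(toWord g))_{k≥1}, is injective. -/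
namespace JamesHopf

section Magnus

theorem head?_ne_of_isChain_cons {X : Type*} {x : X} {w : List X} (h : (x :: w).IsChain (· ≠ ·)) :
    w.head? ≠ some x := by
  cases w with
  | nil => simp
  | cons y w => simpa using (List.isChain_cons_cons.1 h).1.symm

variable {X : Type*} [DecidableEq X]

/-- Left multiplication by `1 + x` on noncommutative power series over `ℤ`, a series being the
function sending a monomial to its coefficient. -/
def mulOneAdd (x : X) (f : List X → ℤ) : List X → ℤ
  | [] => f []
  | y :: w => f (y :: w) + if y = x then f w else 0

/-- Left multiplication by `(1 + x)⁻¹` on noncommutative power series over `ℤ`. -/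
def mulOneAddInv (x : X) (f : List X → ℤ) : List X → ℤ
  | [] => f []
  | y :: w => f (y :: w) - if y = x then mulOneAddInv x f w else 0

/-- Left multiplication by `1 + x` as a permutation of noncommutative power series. -/
def mulOneAddPerm (x : X) : Equiv.Perm (List X → ℤ) where
  toFun := mulOneAdd x
  invFun := mulOneAddInv x
  left_inv f := by
    funext w
    induction w with
    | nil => rfl
    | cons y w ih => simp only [mulOneAddInv, ih, mulOneAdd]; ring
  right_inv f := by
    funext w
    cases w <;> simp [mulOneAdd, mulOneAddInv]

/-- The action of the free group on noncommutative power series by left multiplication through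
the Magnus expansion `x ↦ 1 + x`. -/
def magnusAction : FreeGroup X →* Equiv.Perm (List X → ℤ) :=
  FreeGroup.lift mulOneAddPerm

/-- The noncommutative power series `1`. -/
def oneSeries : List X → ℤ := fun w => if w = [] then 1 else 0

/-- The coefficients of the Magnus expansion of a free group element. -/
def magnus (g : FreeGroup X) : List X → ℤ := magnusAction g oneSeries

theorem magnus_one : magnus (1 : FreeGroup X) = oneSeries := by
  simp [magnus]

theorem magnus_mk_cons_true (x : X) (ℓ : List (X × Bool)) :
    magnus (FreeGroup.mk ((x, true) :: ℓ)) = mulOneAdd x (magnus (FreeGroup.mk ℓ)) := by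
  simp only [magnus, magnusAction, FreeGroup.lift_mk, List.map_cons, List.prod_cons]
  rfl

theorem magnus_mk_cons_false (x : X) (ℓ : List (X × Bool)) :
    magnus (FreeGroup.mk ((x, false) :: ℓ)) = mulOneAddInv x (magnus (FreeGroup.mk ℓ)) := by
  simp only [magnus, magnusAction, FreeGroup.lift_mk, List.map_cons, List.prod_cons]
  rfl

theorem mulOneAddInv_of_head_ne (x : X) (f : List X → ℤ) (w : List X) (hw : w.head? ≠ some x) :
    mulOneAddInv x f w = f w := by
  cases w <;> simp_all [mulOneAddInv]

theorem mulOneAdd_of_head_ne (x : X) (f : List X → ℤ) (w : List X) (hw : w.head? ≠ some x) :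
    mulOneAdd x f w = f w := by
  cases w <;> simp_all [mulOneAdd]

/-- The sign `±1` encoded by a Boolean exponent. -/
def sign (b : Bool) : ℤ := if b then 1 else -1

theorem magnus_mk_cons_of_head_ne (x : X) (b : Bool) (ℓ : List (X × Bool)) (w : List X)
    (hw : w.head? ≠ some x) :
    magnus (FreeGroup.mk ((x, b) :: ℓ)) w = magnus (FreeGroup.mk ℓ) w := by
  cases b
  · rw [magnus_mk_cons_false, mulOneAddInv_of_head_ne _ _ _ hw]
  · rw [magnus_mk_cons_true, mulOneAdd_of_head_ne _ _ _ hw]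

theorem magnus_mk_cons_of_head_eq (x : X) (b : Bool) (ℓ : List (X × Bool)) (w : List X)
    (hw : w.head? ≠ some x) :
    magnus (FreeGroup.mk ((x, b) :: ℓ)) (x :: w) =
      magnus (FreeGroup.mk ℓ) (x :: w) + sign b * magnus (FreeGroup.mk ℓ) w := by
  cases b
  · simp [magnus_mk_cons_false, mulOneAddInv, mulOneAddInv_of_head_ne _ _ _ hw, sign,
      sub_eq_add_neg]
  · simp [magnus_mk_cons_true, mulOneAdd, sign]

/-- The leading behaviour of the Magnus expansion of a nonempty reduced word: `x :: t` lists the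
bases of the syllables of the word, and its coefficient is a nonzero multiple of that of `t`. -/
theorem magnus_leading (ℓ : List (X × Bool)) : ∀ (x : X) (b : Bool),
    FreeGroup.IsReduced ((x, b) :: ℓ) →
    ∃ (t : List X) (n : ℕ), (x :: t).IsChain (· ≠ ·) ∧ 0 < n ∧
      magnus (FreeGroup.mk ((x, b) :: ℓ)) t ≠ 0 ∧
      magnus (FreeGroup.mk ((x, b) :: ℓ)) (x :: t) =
        sign b * n * magnus (FreeGroup.mk ((x, b) :: ℓ)) t ∧
      ∀ w : List X, w.IsChain (· ≠ ·) →
        (t.length + 1 < w.length ∨ t.length + 1 = w.length ∧ w.head? ≠ some x) →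
        magnus (FreeGroup.mk ((x, b) :: ℓ)) w = 0 := by
  induction ℓ with
  | nil =>
    intro x b _
    have h1 : magnus (FreeGroup.mk ([] : List (X × Bool))) = oneSeries := magnus_one
    refine ⟨[], 1, List.isChain_singleton x, one_pos, ?_, ?_, ?_⟩
    · rw [magnus_mk_cons_of_head_ne x b [] [] (by simp), h1]; simp [oneSeries]
    · rw [magnus_mk_cons_of_head_ne x b [] [] (by simp),
        magnus_mk_cons_of_head_eq x b [] [] (by simp), h1]; simp [oneSeries]
    · intro w hw hlen
      by_cases hx : w.head? = some x
      · obtain ⟨w, rfl⟩ := List.head?_eq_some_iff.1 hx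
        rw [magnus_mk_cons_of_head_eq _ _ _ _ (head?_ne_of_isChain_cons hw), h1]
        have : w ≠ [] := by rintro rfl; simp at hlen
        simp [oneSeries, this]
      · rw [magnus_mk_cons_of_head_ne _ _ _ _ hx, h1]
        have : w ≠ [] := by rintro rfl; simp at hlen
        simp [oneSeries, this]
  | cons a ℓ ih =>
    obtain ⟨y, c⟩ := a
    intro x b hred
    obtain ⟨hxy, hred⟩ := FreeGroup.isReduced_cons_cons.1 hred
    obtain ⟨t, n, hchain, hn, hne, heq, hzero⟩ := ih y c hred
    have ht := head?_ne_of_isChain_cons hchain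
    by_cases h : x = y
    · subst h
      obtain rfl : b = c := hxy rfl
      refine ⟨t, n + 1, hchain, by omega, ?_, ?_, ?_⟩
      · rwa [magnus_mk_cons_of_head_ne _ _ _ _ ht]
      · rw [magnus_mk_cons_of_head_ne _ _ _ _ ht, magnus_mk_cons_of_head_eq _ _ _ _ ht, heq]
        push_cast; ring
      · intro w hw hlen
        by_cases hx : w.head? = some x
        · obtain ⟨w, rfl⟩ := List.head?_eq_some_iff.1 hx
          have hw' := head?_ne_of_isChain_cons hw
          rw [magnus_mk_cons_of_head_eq _ _ _ _ hw', hzero _ hw hlen,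
            hzero w hw.tail ?_, mul_zero, add_zero]
          simp at hlen
          rcases Nat.lt_or_ge (t.length + 1) w.length with h | h
          · exact .inl h
          · exact .inr ⟨by omega, hw'⟩
        · rw [magnus_mk_cons_of_head_ne _ _ _ _ hx, hzero _ hw hlen]
    · have hyx : (y :: t).head? ≠ some x := by simpa using Ne.symm h
      have hlead : magnus (FreeGroup.mk ((y, c) :: ℓ)) (y :: t) ≠ 0 := by
        rw [heq]
        refine mul_ne_zero (mul_ne_zero ?_ (by exact_mod_cast hn.ne')) hne
        cases c <;> simp [sign]
      have hchain' : (x :: y :: t).IsChain (· ≠ ·) := List.isChain_cons_cons.2 ⟨h, hchain⟩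
      refine ⟨y :: t, 1, hchain', one_pos, ?_, ?_, ?_⟩
      · rwa [magnus_mk_cons_of_head_ne _ _ _ _ hyx]
      · rw [magnus_mk_cons_of_head_ne _ _ _ _ hyx, magnus_mk_cons_of_head_eq _ _ _ _ hyx,
          hzero (x :: y :: t) hchain' (by simp)]
        simp
      · intro w hw hlen
        simp only [List.length_cons] at hlen
        by_cases hx : w.head? = some x
        · obtain ⟨w, rfl⟩ := List.head?_eq_some_iff.1 hx
          rw [magnus_mk_cons_of_head_eq _ _ _ _ (head?_ne_of_isChain_cons hw),
            hzero _ hw (.inl (by omega)), hzero w hw.tail (.inl ?_), mul_zero, add_zero]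
          simp at hlen; omega
        · rw [magnus_mk_cons_of_head_ne _ _ _ _ hx, hzero _ hw (.inl (by omega))]

theorem magnus_injective : Function.Injective (magnus : FreeGroup X → List X → ℤ) := by
  intro g h hgh
  have hone : magnus (h⁻¹ * g) = oneSeries := by
    have hgh' : magnusAction g oneSeries = magnusAction h oneSeries := hgh
    simp [magnus, hgh', map_mul, map_inv]
  suffices h⁻¹ * g = 1 from (inv_mul_eq_one.1 this).symm
  generalize h⁻¹ * g = k at hone
  rw [← FreeGroup.toWord_eq_nil_iff]
  have hred : FreeGroup.IsReduced k.toWord := FreeGroup.isReduced_toWord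
  rw [← FreeGroup.mk_toWord (x := k)] at hone
  cases hk : k.toWord with
  | nil => rfl
  | cons a ℓ =>
    obtain ⟨x, b⟩ := a
    rw [hk] at hred hone
    obtain ⟨t, n, -, hn, hne, heq, -⟩ := magnus_leading ℓ x b hred
    have hsign : sign b ≠ 0 := by cases b <;> simp [sign]
    have hn' : (n : ℤ) ≠ 0 := by exact_mod_cast hn.ne'
    exact absurd (by simp [hone, oneSeries] :
      magnus (FreeGroup.mk ((x, b) :: ℓ)) (x :: t) = 0)
      (heq ▸ mul_ne_zero (mul_ne_zero hsign hn') hne)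

end Magnus

section Coefficients

variable {X : Type*}

open Classical in
/-- The contribution of a sequence of positions in `ℓ` to the exponent sum of the generator `u`
in the James–Hopf word of `ℓ`. -/
noncomputable def weight (ℓ : List (X × Bool)) {k : ℕ} (u : Fin k → X)
    (s : Fin k → Fin ℓ.length) : ℤ :=
  if Admissible ℓ (fun j => (s j : ℕ)) ∧ ∀ j, (ℓ.get (s j)).1 = u j then
    ∏ j, sign (ℓ.get (s j)).2
  else 0

/-- The exponent sum of the generator `u` in the James–Hopf word of `ℓ`. -/
noncomputable def coeff (ℓ : List (X × Bool)) {k : ℕ} (u : Fin k → X) : ℤ :=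
  ∑ s, weight ℓ u s

open Classical in
/-- The exponent sum of a generator, as a group homomorphism. -/
noncomputable def exponentSum {Y : Type*} (u : Y) : FreeGroup Y →* Multiplicative ℤ :=
  FreeGroup.lift fun v => Multiplicative.ofAdd (if v = u then 1 else 0)

theorem exponentSum_jamesHopfWord (k : ℕ) (ℓ : List (X × Bool)) (u : Fin k → X) :
    exponentSum u (jamesHopfWord k ℓ) = Multiplicative.ofAdd (coeff ℓ u) := by
  classical
  have hrange (n : ℕ) (f : ℕ → Multiplicative ℤ) :
      ((List.range n).map f).prod = ∏ i : Fin n, f i := by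
    rw [← Finset.prod_range, ← List.prod_toFinset _ List.nodup_range, List.toFinset_range]
  rw [jamesHopfWord, map_list_prod, List.map_map, coeff, ofAdd_sum, hrange,
    ← Equiv.prod_comp finFunctionFinEquiv.symm]
  refine Finset.prod_congr rfl fun c _ => ?_
  have hs (j : Fin k) : ((finFunctionFinEquiv.symm c j : Fin ℓ.length) : ℕ) =
      c / ℓ.length ^ (j : ℕ) % ℓ.length := rfl
  generalize finFunctionFinEquiv.symm c = s at hs
  simp only [Function.comp_apply, ← hs, weight]
  by_cases h : Admissible ℓ (fun j => (s j : ℕ))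
  · rw [dif_pos h, map_zpow]
    simp only [exponentSum, FreeGroup.lift_apply_of, ← ofAdd_zsmul, List.prod_ofFn, h, true_and,
      funext_iff, Fin.eta, sign]
    split_ifs <;> simp
  · simp [h]

theorem admissible_cons_succ (a : X × Bool) (ℓ : List (X × Bool)) {k : ℕ} (s : Fin k → ℕ) :
    Admissible (a :: ℓ) (fun j => s j + 1) ↔ Admissible ℓ s := by
  simp [Admissible]

theorem monotone_of_admissible {ℓ : List (X × Bool)} {k : ℕ} {s : Fin k → ℕ}
    (h : Admissible ℓ s) : Monotone s := by
  cases k with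
  | zero => exact fun i => i.elim0
  | succ k =>
    refine Fin.monotone_iff_le_succ.2 fun i => ?_
    have := h.2 i (by omega)
    split_ifs at this
    · exact this.le
    · exact this

theorem weight_cons_succ (a : X × Bool) (ℓ : List (X × Bool)) {k : ℕ} (u : Fin k → X)
    (s : Fin k → Fin ℓ.length) :
    weight (a :: ℓ) u (fun j => (s j).succ) = weight ℓ u s := by
  classical exact if_congr (and_congr (admissible_cons_succ a ℓ fun j => s j) Iff.rfl) rfl rfl

theorem admissible_cons_zero_cons_succ (x : X) (ℓ : List (X × Bool)) {k : ℕ}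
    (s : Fin k → ℕ) :
    Admissible ((x, true) :: ℓ) (Fin.cons 0 (fun j => s j + 1) : Fin (k + 1) → ℕ) ↔
      Admissible ℓ s := by
  rw [← admissible_cons_succ (x, true) ℓ s]
  refine and_congr (by simp [Fin.forall_fin_succ]) ⟨fun h j hj => ?_, fun h j hj => ?_⟩
  · exact h (j + 1) (by omega)
  · cases j with
    | zero =>
      change if _ then 0 < s ⟨0, by omega⟩ + 1 else 0 ≤ s ⟨0, by omega⟩ + 1
      simp
    | succ j => exact h j (by omega)

theorem admissible_cons_zero_cons (x : X) (ℓ : List (X × Bool)) {k : ℕ}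
    (s : Fin k → ℕ) :
    Admissible ((x, false) :: ℓ) (Fin.cons 0 s : Fin (k + 1) → ℕ) ↔
      Admissible ((x, false) :: ℓ) s := by
  refine and_congr (by simp [Fin.forall_fin_succ]) ⟨fun h j hj => ?_, fun h j hj => ?_⟩
  · exact h (j + 1) (by omega)
  · cases j with
    | zero =>
      change if (List.map Prod.snd ((x, false) :: ℓ)).getD (s ⟨0, by omega⟩) true = true then
        0 < s ⟨0, by omega⟩ else 0 ≤ s ⟨0, by omega⟩
      rcases Nat.eq_zero_or_pos (s ⟨0, by omega⟩) with h0 | h0 <;> simp [h0]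
    | succ j => exact h j (by omega)

theorem weight_cons_true_cons_zero (x : X) (ℓ : List (X × Bool)) {k : ℕ} (u : Fin (k + 1) → X)
    (s : Fin k → Fin ℓ.length) (hx : u 0 = x) :
    weight ((x, true) :: ℓ) u
        (Fin.cons 0 (fun j => (s j).succ) : Fin (k + 1) → Fin (ℓ.length + 1)) =
      weight ℓ (Fin.tail u) s := by
  classical
  refine if_congr (and_congr ?_ ?_) ?_ rfl
  · rw [← admissible_cons_zero_cons_succ x ℓ fun j => s j]
    refine iff_of_eq (congrArg _ (funext fun j => ?_))
    cases j using Fin.cases <;> simp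
  · simp [Fin.forall_fin_succ, hx, Fin.tail]
  · simp [Fin.prod_univ_succ, sign]

theorem weight_cons_false_cons_zero (x : X) (ℓ : List (X × Bool)) {k : ℕ} (u : Fin (k + 1) → X)
    (s : Fin k → Fin (ℓ.length + 1)) (hx : u 0 = x) :
    weight ((x, false) :: ℓ) u (Fin.cons 0 s : Fin (k + 1) → Fin (ℓ.length + 1)) =
      -weight ((x, false) :: ℓ) (Fin.tail u) s := by
  rw [weight, weight, apply_ite Neg.neg, neg_zero]
  classical
  refine if_congr (and_congr ?_ ?_) ?_ rfl
  · rw [← admissible_cons_zero_cons x ℓ fun j => s j]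
    refine iff_of_eq (congrArg _ (funext fun j => ?_))
    cases j using Fin.cases <;> simp
  · simp [Fin.forall_fin_succ, hx, Fin.tail]
  · simp [Fin.prod_univ_succ, sign]

/-- Admissible sequences for `a :: ℓ` avoiding the initial letter at their first position avoid it
altogether, hence contribute the exponent sum for `ℓ`. -/
theorem sum_weight_first_ne_zero (a : X × Bool) (ℓ : List (X × Bool)) {k : ℕ}
    (u : Fin (k + 1) → X) :
    (∑ s : Fin (k + 1) → Fin (ℓ.length + 1), if s 0 = 0 then 0 else weight (a :: ℓ) u s) =
      coeff ℓ u := by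
  refine (Fintype.sum_of_injective (fun (s : Fin (k + 1) → Fin ℓ.length) j => (s j).succ)
    (fun s t h => funext fun j => Fin.succ_injective _ (congrFun h j)) _ _ (fun s hs => ?_)
    (fun s => ?_)).symm
  · split_ifs with h0
    · rfl
    · refine if_neg fun h => hs ?_
      have hpos (j) : s j ≠ 0 := fun hj => h0 <| by
        have := monotone_of_admissible h.1 (Fin.zero_le j)
        simp only [hj] at this
        exact Fin.ext (Nat.le_zero.1 this)
      exact ⟨fun j => (s j).pred (hpos j), by simp⟩
  · simp [weight_cons_succ]

theorem coeff_cons_succ (a : X × Bool) (ℓ : List (X × Bool)) {k : ℕ} (u : Fin (k + 1) → X) :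
    coeff (a :: ℓ) u = coeff ℓ u +
      ∑ s : Fin k → Fin (ℓ.length + 1),
        weight (a :: ℓ) u (Fin.cons 0 s : Fin (k + 1) → Fin (ℓ.length + 1)) := by
  have hsplit : coeff (a :: ℓ) u =
      (∑ s : Fin (k + 1) → Fin (ℓ.length + 1), if s 0 = 0 then 0 else weight (a :: ℓ) u s) +
        ∑ s : Fin (k + 1) → Fin (ℓ.length + 1), if s 0 = 0 then weight (a :: ℓ) u s else 0 := by
    rw [← Finset.sum_add_distrib]
    refine Finset.sum_congr rfl fun s _ => ?_
    by_cases h : s 0 = 0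
    · rw [if_pos h, if_pos h, zero_add]
    · rw [if_neg h, if_neg h, add_zero]
  rw [hsplit, sum_weight_first_ne_zero]
  congr 1
  refine (Fintype.sum_of_injective
    (fun s : Fin k → Fin (ℓ.length + 1) => (Fin.cons 0 s : Fin (k + 1) → Fin (ℓ.length + 1)))
    (Fin.cons_right_injective (α := fun _ => Fin (ℓ.length + 1)) 0) _ _
    (fun s hs => if_neg fun h => hs ⟨Fin.tail s, ?_⟩)
    (fun s => ?_)).symm
  · rw [← h]; exact Fin.cons_self_tail s
  · simp

theorem weight_cons_zero_of_ne (a : X × Bool) (ℓ : List (X × Bool)) {k : ℕ}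
    (u : Fin (k + 1) → X) (s : Fin k → Fin (ℓ.length + 1)) (h : u 0 ≠ a.1) :
    weight (a :: ℓ) u (Fin.cons 0 s : Fin (k + 1) → Fin (ℓ.length + 1)) = 0 :=
  if_neg fun h' => h (h'.2 0).symm

theorem coeff_cons_of_ne (a : X × Bool) (ℓ : List (X × Bool)) {k : ℕ}
    (u : Fin (k + 1) → X) (h : u 0 ≠ a.1) : coeff (a :: ℓ) u = coeff ℓ u := by
  simp [coeff_cons_succ, weight_cons_zero_of_ne _ _ _ _ h]

theorem coeff_cons_false (x : X) (ℓ : List (X × Bool)) {k : ℕ} (u : Fin (k + 1) → X)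
    (hx : u 0 = x) :
    coeff ((x, false) :: ℓ) u = coeff ℓ u - coeff ((x, false) :: ℓ) (Fin.tail u) := by
  rw [coeff_cons_succ, sub_eq_add_neg, coeff.eq_def (_ :: _), ← Finset.sum_neg_distrib]
  exact congrArg _ (Finset.sum_congr rfl fun s _ => weight_cons_false_cons_zero x ℓ u s hx)

theorem coeff_cons_true (x : X) (ℓ : List (X × Bool)) {k : ℕ} (u : Fin (k + 1) → X)
    (hx : u 0 = x) :
    coeff ((x, true) :: ℓ) u = coeff ℓ u + coeff ℓ (Fin.tail u) := by
  rw [coeff_cons_succ]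
  congr 1
  refine (Fintype.sum_of_injective (fun (s : Fin k → Fin ℓ.length) j => (s j).succ)
    (fun s t h => funext fun j => Fin.succ_injective _ (congrFun h j)) _ _ (fun s hs => ?_)
    (fun s => (weight_cons_true_cons_zero x ℓ u s hx).symm)).symm
  refine if_neg fun h => hs ?_
  have hpos (j) : s j ≠ 0 := by
    cases k with
    | zero => exact j.elim0
    | succ k =>
      intro hj
      have h1 := h.1.2 0 (by omega)
      have h2 := monotone_of_admissible h.1
        (show (1 : Fin (k + 2)) ≤ j.succ from Fin.succ_le_succ_iff.2 j.zero_le)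
      simp only [Fin.cons_succ, hj] at h2
      change if (List.map Prod.snd ((x, true) :: ℓ)).getD (s 0) true = true then
        0 < (s 0 : ℕ) else 0 ≤ (s 0 : ℕ) at h1
      have h0 : (s 0 : ℕ) = 0 := Nat.le_zero.1 h2
      simp [h0] at h1
  exact ⟨fun j => (s j).pred (hpos j), by simp⟩

theorem coeff_zero (ℓ : List (X × Bool)) (u : Fin 0 → X) : coeff ℓ u = 1 := by
  simp [coeff, weight, Admissible]

theorem coeff_eq_magnus [DecidableEq X] (ℓ : List (X × Bool)) {k : ℕ} (u : Fin k → X) :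
    coeff ℓ u = magnus (FreeGroup.mk ℓ) (List.ofFn u) := by
  induction ℓ generalizing k with
  | nil =>
    rw [← FreeGroup.one_eq_mk, magnus_one]
    cases k with
    | zero => simp [coeff_zero, oneSeries]
    | succ k =>
      have : IsEmpty (Fin (k + 1) → Fin ([] : List (X × Bool)).length) :=
        ⟨fun s => (s 0).elim0⟩
      simp [coeff, oneSeries]
  | cons a ℓ ih =>
    obtain ⟨x, b⟩ := a
    induction k with
    | zero =>
      rw [coeff_zero, List.ofFn_zero, magnus_mk_cons_of_head_ne _ _ _ _ (by simp),
        ← List.ofFn_zero (f := u), ← ih, coeff_zero]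
    | succ k ihk =>
      by_cases hx : u 0 = x
      · cases b
        · rw [coeff_cons_false x ℓ u hx, ih, ihk, magnus_mk_cons_false, List.ofFn_succ]
          simp [mulOneAddInv, hx, Fin.tail_def]
        · rw [coeff_cons_true x ℓ u hx, ih, ih, magnus_mk_cons_true, List.ofFn_succ]
          simp [mulOneAdd, hx, Fin.tail_def]
      · rw [coeff_cons_of_ne _ _ _ hx, magnus_mk_cons_of_head_ne _ _ _ _ (by simpa using hx), ih]

end Coefficients

end JamesHopf

/-- The total James–Hopf map `H = ∏_{k≥1} H_k` is injective: if
`φ_k (toWord g) = φ_k (toWord h)` for every `k ≥ 1`, then `g = h`. -/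
theorem jamesHopf_total_injective {X : Type*} [DecidableEq X]
    (g h : FreeGroup X)
    (hgh : ∀ k : ℕ, 1 ≤ k →
      jamesHopfWord k (FreeGroup.toWord g) = jamesHopfWord k (FreeGroup.toWord h)) :
    g = h := by
  refine JamesHopf.magnus_injective (funext fun w => ?_)
  rw [← FreeGroup.mk_toWord (x := g), ← FreeGroup.mk_toWord (x := h), ← List.ofFn_get w,
    ← JamesHopf.coeff_eq_magnus, ← JamesHopf.coeff_eq_magnus]
  rcases Nat.eq_zero_or_pos w.length with hw | hw
  · obtain rfl := List.length_eq_zero_iff.1 hw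
    exact (JamesHopf.coeff_zero _ _).trans (JamesHopf.coeff_zero _ _).symm
  · refine Multiplicative.ofAdd.injective ?_
    rw [← JamesHopf.exponentSum_jamesHopfWord, ← JamesHopf.exponentSum_jamesHopfWord,
      hgh _ hw]
end
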